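/- Let N, k, ℓ be integers with 0 ≤ ℓ ≤ N and 0 ≤ k ≤ N, and set Ω = {1,…,N} \ {1,…,ℓ}. Then in K: Σ_{n=0}^{min(ℓ,k)} Σ_{L ⊆ {1,…,ℓ}, |L| = n} q^{n−ℓ} x_L · (1/(q^{-1};t^{-1})_{N−k}) · Σ_{J ⊆ Ω, |J| = k−n} x_J = Σ_{n=0}^{min(ℓ,k)} Σ_{L ⊆ {1,…,ℓ}, |L| = n} q^{n−ℓ} x_L · Σ_{m'=0}^{N−k−ℓ+n} (q^{-m'}/(t^{k−N+1}q^{-1};t)_{m'+ℓ−n}) · Σ_{J ⊆ Ω, |J| = k−n} x_J Σ_{J' ⊆ Ω∖J, |J'| = m'} Ã_{J∪J'}^{Ω}, where a sum over m' from 0 to N−k−ℓ+n is empty when N−k−ℓ+n < 0. -/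

import Mathlib

open Finset MvPolynomial

set_option synthInstance.maxHeartbeats 1000000
set_option maxHeartbeats 1000000

noncomputable section

/-- The field ℚ(q,t): fraction field of ℚ[q,t] (variables indexed by `Bool`). -/
abbrev Fqt : Type := FractionRing (MvPolynomial Bool ℚ)

/-- The polynomial ring ℚ(q,t)[x₁,…,x_N]. -/
abbrev Rx (N : ℕ) : Type := MvPolynomial (Fin N) Fqt

/-- The field K = ℚ(q,t,x₁,…,x_N), realized as the fraction field of ℚ(q,t)[x₁,…,x_N]. -/
abbrev K (N : ℕ) : Type := FractionRing (Rx N)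

/-- The indeterminate q, as an element of K. -/
def qK (N : ℕ) : K N :=
  algebraMap (Rx N) (K N) (C (algebraMap (MvPolynomial Bool ℚ) Fqt (X true)))

/-- The indeterminate t, as an element of K. -/
def tK (N : ℕ) : K N :=
  algebraMap (Rx N) (K N) (C (algebraMap (MvPolynomial Bool ℚ) Fqt (X false)))

/-- The indeterminate x_i, as an element of K. -/
def xK {N : ℕ} (i : Fin N) : K N := algebraMap (Rx N) (K N) (X i)

/-- The q-Pochhammer symbol (a;b)_n = ∏_{i=0}^{n-1} (1 - a·bⁱ). -/
def poch {F : Type*} [Field F] (a b : F) (n : ℕ) : F :=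
  ∏ i ∈ Finset.range n, (1 - a * b ^ i)

/-- x_I = ∏_{i ∈ I} x_i. -/
def xProd {N : ℕ} (I : Finset (Fin N)) : K N := ∏ i ∈ I, xK i

/-- Ã_I^J = ∏_{i ∈ I, j ∈ J∖I} (x_i − t⁻¹x_j)/(x_i − x_j). -/
def Atilde {N : ℕ} (I J : Finset (Fin N)) : K N :=
  ∏ i ∈ I, ∏ j ∈ J \ I, (xK i - (tK N)⁻¹ * xK j) / (xK i - xK j)


/-- The set {1,…,N} ∖ {1,…,ℓ}, i.e. the last N − ℓ of the N variable indices. -/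
def highSet (N ℓ : ℕ) : Finset (Fin N) := Finset.univ.filter fun i => ℓ ≤ (i : ℕ)

/-- The set {1,…,ℓ}, i.e. the first ℓ of the N variable indices. -/
def lowSet (N ℓ : ℕ) : Finset (Fin N) := Finset.univ.filter fun i => (i : ℕ) < ℓ

/-- Shortcut instance to speed up typeclass search on K. -/
noncomputable instance instKField (N : ℕ) : Field (K N) := inferInstance

section SymmetricSums

variable {F ι : Type*} [Field F]

/-- The Gaussian binomial coefficient, defined by the `q`-Pascal recursion. -/
def gaussBinom (u : F) : ℕ → ℕ → F
  | _, 0 => 1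
  | 0, _ + 1 => 0
  | d + 1, n + 1 => u ^ (n + 1) * gaussBinom u d (n + 1) + gaussBinom u d n

lemma gaussBinom_zero_right (u : F) (d : ℕ) : gaussBinom u d 0 = 1 := by
  cases d <;> rfl

lemma gaussBinom_succ_succ (u : F) (d n : ℕ) :
    gaussBinom u (d + 1) (n + 1) = u ^ (n + 1) * gaussBinom u d (n + 1) + gaussBinom u d n := rfl

lemma gaussBinom_eq_zero (u : F) {d n : ℕ} (h : d < n) : gaussBinom u d n = 0 := by
  induction d generalizing n with
  | zero => obtain ⟨m, rfl⟩ := Nat.exists_eq_succ_of_ne_zero h.ne_bot; rfl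
  | succ d ih =>
    obtain ⟨m, rfl⟩ := Nat.exists_eq_succ_of_ne_zero (by omega : n ≠ 0)
    rw [Nat.succ_eq_add_one, gaussBinom_succ_succ, ih (by omega), ih (by omega)]
    ring

lemma one_sub_pow_mul_gaussBinom_succ_succ (u : F) (d n : ℕ) :
    (1 - u ^ (n + 1)) * gaussBinom u (d + 1) (n + 1) = (1 - u ^ (d + 1)) * gaussBinom u d n := by
  induction d generalizing n with
  | zero =>
    rw [gaussBinom_succ_succ, gaussBinom_eq_zero u (Nat.succ_pos n)]
    cases n with
    | zero => simp [gaussBinom_zero_right]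
    | succ n => simp [gaussBinom_eq_zero u (Nat.succ_pos n)]
  | succ d ih =>
    rw [gaussBinom_succ_succ u (d + 1) n]
    cases n with
    | zero =>
      have h := ih 0
      simp only [gaussBinom_zero_right] at h ⊢
      linear_combination u ^ 1 * h
    | succ n =>
      have h := ih (n + 1)
      have h' := ih n
      linear_combination u ^ (n + 2) * h + u * h'
        - u * (1 - u ^ (d + 1)) * gaussBinom_succ_succ u d n

lemma sum_pow_mul_poch_mul_gaussBinom (u z : F) (d : ℕ) :
    ∑ n ∈ range (d + 1), z ^ (d - n) * poch z u n * gaussBinom u d n = 1 := by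
  induction d with
  | zero => simp [poch, gaussBinom_zero_right]
  | succ d ih =>
    have hsucc (n : ℕ) : poch z u (n + 1) = poch z u n * (1 - z * u ^ n) := prod_range_succ _ _
    have hsplit : ∑ n ∈ range (d + 1 + 1), z ^ (d + 1 - n) * poch z u n * gaussBinom u (d + 1) n
        = ∑ n ∈ range (d + 1 + 1), z ^ (d + 1 - n) * poch z u n * (u ^ n * gaussBinom u d n)
          + ∑ n ∈ range (d + 1), z ^ (d - n) * poch z u (n + 1) * gaussBinom u d n := by
      rw [sum_range_succ', sum_range_succ' _ (d + 1)]
      simp only [gaussBinom_succ_succ, gaussBinom_zero_right, Nat.add_sub_add_right, mul_add,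
        sum_add_distrib, pow_zero, mul_one]
      ring
    rw [hsplit, sum_range_succ, gaussBinom_eq_zero u (Nat.lt_succ_self d)]
    simp only [mul_zero, add_zero]
    rw [← sum_add_distrib, ← ih]
    refine sum_congr rfl fun n hn => ?_
    rw [hsucc, Nat.succ_sub (by simpa [Nat.lt_succ_iff] using hn), pow_succ]
    ring

/-- The elementary symmetric sum of degree `r` in the values of `x` on `S`. -/
def elemSum (x : ι → F) (r : ℕ) (S : Finset ι) : F := ∑ J ∈ powersetCard r S, ∏ i ∈ J, x i

lemma prod_X_add_C_coeff_elemSum (x : ι → F) (S : Finset ι) {r : ℕ} (hr : r ≤ #S) :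
    (∏ i ∈ S, (Polynomial.X + Polynomial.C (x i))).coeff (#S - r) = elemSum x r S := by
  rw [Finset.prod_X_add_C_coeff _ _ (Nat.sub_le _ _), Nat.sub_sub_self hr]
  rfl

variable [DecidableEq ι]

/-- The product of `(x i - u * x j) / (x i - x j)` over `i ∈ I`, `j ∈ S`. -/
def crossProd (u : F) (x : ι → F) (I S : Finset ι) : F :=
  ∏ i ∈ I, ∏ j ∈ S, (x i - u * x j) / (x i - x j)

lemma crossProd_mul_crossProd (u : F) (x : ι → F) {I S : Finset ι} {j : ι} (hI : I ⊆ S)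
    (hj : j ∈ S \ I) :
    crossProd u x I (S \ I) * crossProd u x ((S \ I).erase j) {j}
      = crossProd u x (S.erase j) {j} * crossProd u x I (S.erase j \ I) := by
  have hjI : j ∉ I := (mem_sdiff.mp hj).2
  have h1 : crossProd u x I (S \ I)
      = crossProd u x I {j} * crossProd u x I ((S \ I).erase j) := by
    simp only [crossProd, prod_singleton]
    rw [← prod_mul_distrib]
    exact prod_congr rfl fun i _ => (mul_prod_erase _ _ hj).symm
  have h2 : crossProd u x (S.erase j) {j}
      = crossProd u x I {j} * crossProd u x ((S \ I).erase j) {j} := by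
    have hIS : I ⊆ S.erase j := fun i hi => mem_erase.mpr ⟨fun h => hjI (h ▸ hi), hI hi⟩
    rw [crossProd, ← prod_sdiff hIS, mul_comm, erase_sdiff_comm]
    rfl
  rw [h1, h2, erase_sdiff_comm]
  ring

lemma sum_crossProd_mul_elemSum_erase (u : F) {x : ι → F} (hx : Function.Injective x)
    (hx0 : ∀ i, x i ≠ 0) (S : Finset ι) {r : ℕ} (hr : r ≤ #S) :
    (1 - u) * ∑ j ∈ S, crossProd u x (S.erase j) {j} * elemSum x r (S.erase j)
      = (1 - u ^ (#S - r)) * elemSum x r S := by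
  have key : Polynomial.X * (Polynomial.C (1 - u) * ∑ j ∈ S,
        Polynomial.C (crossProd u x (S.erase j) {j})
          * ∏ i ∈ S.erase j, (Polynomial.X + Polynomial.C (x i)))
      = ∏ i ∈ S, (Polynomial.X + Polynomial.C (x i))
        - (∏ i ∈ S, (Polynomial.X + Polynomial.C (x i))).comp (Polynomial.C u * Polynomial.X) := by
    classical
    have hinj : Function.Injective fun k => -x k := neg_injective.comp hx
    have h0 : (0 : F) ∉ S.image fun k => -x k := by simp [hx0]
    have hcard : #(insert 0 (S.image fun k => -x k)) = #S + 1 := by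
      rw [card_insert_of_notMem h0, card_image_of_injective S hinj]
    have hdeg (T : Finset ι) :
        (∏ i ∈ T, (Polynomial.X + Polynomial.C (x i))).natDegree = #T := by
      rw [Polynomial.natDegree_prod_of_monic _ _ fun i _ => Polynomial.monic_X_add_C (x i)]
      simp
    have hlt {p : Polynomial F} (hp : p.natDegree ≤ #S) :
        p.degree < #(insert 0 (S.image fun k => -x k)) := by
      rw [hcard]
      exact Polynomial.degree_le_natDegree.trans_lt (by exact_mod_cast Nat.lt_succ_of_le hp)
    refine Polynomial.eq_of_degrees_lt_of_eval_finset_eq _ (hlt ?_) (hlt ?_) ?_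
    · rw [mul_sum, mul_sum]
      refine Polynomial.natDegree_sum_le_of_forall_le _ _ fun j hj => ?_
      refine Polynomial.natDegree_mul_le.trans ?_
      rw [Polynomial.natDegree_X]
      have h1 := Polynomial.natDegree_C_mul_le (1 - u)
        (Polynomial.C (crossProd u x (S.erase j) {j})
          * ∏ i ∈ S.erase j, (Polynomial.X + Polynomial.C (x i)))
      have h2 := Polynomial.natDegree_C_mul_le (crossProd u x (S.erase j) {j})
        (∏ i ∈ S.erase j, (Polynomial.X + Polynomial.C (x i)))
      have h3 := card_erase_add_one hj
      rw [hdeg] at h2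
      omega
    · refine (Polynomial.natDegree_sub_le _ _).trans (max_le (hdeg S).le ?_)
      refine Polynomial.natDegree_comp_le.trans ?_
      rw [hdeg]
      exact (Nat.mul_le_mul_left _ ((Polynomial.natDegree_C_mul_le u _).trans
        Polynomial.natDegree_X_le)).trans (mul_one _).le
    · intro y hy
      rcases mem_insert.mp hy with rfl | hy
      · simp [Polynomial.eval_prod]
      · obtain ⟨k, hk, rfl⟩ := mem_image.mp hy
        simp only [Polynomial.eval_mul, Polynomial.eval_sub, Polynomial.eval_comp,
          Polynomial.eval_finsetSum, Polynomial.eval_prod, Polynomial.eval_add,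
          Polynomial.eval_X, Polynomial.eval_C]
        rw [sum_eq_single_of_mem k hk, ← mul_prod_erase S _ hk, ← mul_prod_erase S _ hk,
          crossProd, ← prod_mul_distrib]
        · have hprod : ∏ i ∈ S.erase k,
              ((∏ j ∈ {k}, (x i - u * x j) / (x i - x j)) * (-x k + x i))
              = ∏ i ∈ S.erase k, (u * -x k + x i) := by
            refine prod_congr rfl fun i hi => ?_
            have hne : x i - x k ≠ 0 := sub_ne_zero.mpr (hx.ne (ne_of_mem_erase hi))
            rw [prod_singleton]
            field_simp
            ring
          rw [hprod]
          ring
        · intro j _ hjk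
          rw [prod_eq_zero (mem_erase.mpr ⟨hjk.symm, hk⟩) (neg_add_cancel _), mul_zero]
  rcases hr.eq_or_lt with rfl | hlt
  · rw [Nat.sub_self, pow_zero, sub_self, zero_mul, sum_eq_zero, mul_zero]
    intro j hj
    rw [elemSum, powersetCard_eq_empty.mpr (card_erase_lt_of_mem hj), sum_empty, mul_zero]
  · have hcoeff := congrArg (Polynomial.coeff · (#S - r)) key
    have hd : #S - r = #S - 1 - r + 1 := by omega
    simp only [Polynomial.coeff_sub, Polynomial.comp_C_mul_X_coeff,
      prod_X_add_C_coeff_elemSum x S hr] at hcoeff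
    rw [hd, Polynomial.coeff_X_mul, Polynomial.coeff_C_mul, Polynomial.finsetSum_coeff] at hcoeff
    have hsum : ∑ j ∈ S, (Polynomial.C (crossProd u x (S.erase j) {j})
          * ∏ i ∈ S.erase j, (Polynomial.X + Polynomial.C (x i))).coeff (#S - 1 - r)
        = ∑ j ∈ S, crossProd u x (S.erase j) {j} * elemSum x r (S.erase j) := by
      refine sum_congr rfl fun j hj => ?_
      have hc := card_erase_of_mem hj
      rw [Polynomial.coeff_C_mul, ← hc, prod_X_add_C_coeff_elemSum x _ (by omega)]
    rw [← hsum, hcoeff, ← hd]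
    ring

lemma sum_crossProd_mul_elemSum {u : F} (hu : ∀ n : ℕ, u ^ (n + 1) ≠ 1) {x : ι → F}
    (hx : Function.Injective x) (hx0 : ∀ i, x i ≠ 0) {s r : ℕ} (hr : r ≤ s) (n : ℕ)
    (S : Finset ι) (hS : #S = s + n) :
    ∑ I ∈ powersetCard s S, crossProd u x I (S \ I) * elemSum x r I
      = gaussBinom u (s + n - r) n * elemSum x r S := by
  induction n generalizing S with
  | zero =>
    rw [add_zero] at hS
    rw [← hS, powersetCard_self]
    simp [crossProd, gaussBinom_zero_right]
  | succ n ih =>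
    have hcompl (I : Finset ι) (hI : I ∈ powersetCard s S) :
        (1 - u) * ∑ j ∈ S \ I, crossProd u x ((S \ I).erase j) {j} = 1 - u ^ (n + 1) := by
      obtain ⟨hIS, hIc⟩ := mem_powersetCard.mp hI
      have h := sum_crossProd_mul_elemSum_erase u hx hx0 (S \ I) (Nat.zero_le _)
      have hc : #(S \ I) = n + 1 := by rw [card_sdiff_of_subset hIS]; omega
      simpa [elemSum, hc] using h
    have hne : 1 - u ^ (n + 1) ≠ 0 := sub_ne_zero.mpr (hu n).symm
    apply mul_left_cancel₀ hne
    calc (1 - u ^ (n + 1)) * ∑ I ∈ powersetCard s S, crossProd u x I (S \ I) * elemSum x r I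
        = (1 - u) * ∑ I ∈ powersetCard s S, ∑ j ∈ S \ I,
            crossProd u x (S.erase j) {j} *
              (crossProd u x I (S.erase j \ I) * elemSum x r I) := by
          rw [mul_sum, mul_sum]
          refine sum_congr rfl fun I hI => ?_
          rw [← hcompl I hI, mul_assoc, sum_mul]
          congr 1
          refine sum_congr rfl fun j hj => ?_
          have := crossProd_mul_crossProd u x (mem_powersetCard.mp hI).1 hj
          linear_combination elemSum x r I * this
      _ = (1 - u) * ∑ j ∈ S, ∑ I ∈ powersetCard s (S.erase j),
            crossProd u x (S.erase j) {j} *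
              (crossProd u x I (S.erase j \ I) * elemSum x r I) := by
          congr 1
          refine sum_comm' fun I j => ?_
          simp only [mem_powersetCard, mem_sdiff, subset_erase]
          tauto
      _ = (1 - u) * ∑ j ∈ S, gaussBinom u (s + n - r) n *
            (crossProd u x (S.erase j) {j} * elemSum x r (S.erase j)) := by
          congr 1
          refine sum_congr rfl fun j hj => ?_
          rw [← mul_sum, ih (S.erase j) (by rw [card_erase_of_mem hj]; omega)]
          ring
      _ = _ := by
          rw [← mul_sum]
          have h := sum_crossProd_mul_elemSum_erase u hx hx0 S (r := r) (by omega)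
          have hd : s + (n + 1) - r = s + n - r + 1 := by omega
          have hg := one_sub_pow_mul_gaussBinom_succ_succ u (s + n - r) n
          rw [hS, hd] at h
          rw [hd]
          linear_combination gaussBinom u (s + n - r) n * h - elemSum x r S * hg

lemma sum_powersetCard_mul_sum_sdiff (f : Finset ι → F) (x : ι → F) (r m : ℕ) (S : Finset ι) :
    ∑ J ∈ powersetCard r S, (∏ i ∈ J, x i) * ∑ J' ∈ powersetCard m (S \ J), f (J ∪ J')
      = ∑ I ∈ powersetCard (r + m) S, f I * elemSum x r I := by
  have hinner (J : Finset ι) (hJ : J ∈ powersetCard r S) :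
      ∑ J' ∈ powersetCard m (S \ J), f (J ∪ J')
        = ∑ I ∈ powersetCard (r + m) S with J ⊆ I, f I := by
    obtain ⟨hJS, hJc⟩ := mem_powersetCard.mp hJ
    refine sum_bij' (fun J' _ => J ∪ J') (fun I _ => I \ J) ?_ ?_ ?_ ?_ ?_
    · intro J' h
      obtain ⟨h1, h2⟩ := mem_powersetCard.mp h
      have hd : Disjoint J J' := disjoint_sdiff.mono_right h1
      simp only [mem_filter, mem_powersetCard]
      exact ⟨⟨union_subset hJS (h1.trans sdiff_subset), by
        rw [card_union_of_disjoint hd, hJc, h2]⟩, subset_union_left⟩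
    · intro I h
      simp only [mem_filter, mem_powersetCard] at h ⊢
      exact ⟨sdiff_subset_sdiff h.1.1 le_rfl, by
        rw [card_sdiff_of_subset h.2]; omega⟩
    · intro J' h
      have hd : Disjoint J J' := disjoint_sdiff.mono_right (mem_powersetCard.mp h).1
      exact union_sdiff_cancel_left hd
    · intro I h
      exact union_sdiff_of_subset (mem_filter.mp h).2
    · intro _ _
      rfl
  simp only [elemSum, mul_sum]
  rw [sum_congr rfl fun J hJ => by rw [← mul_sum, hinner J hJ, mul_sum]]
  rw [sum_comm' (s' := fun I => powersetCard r I) (t' := powersetCard (r + m) S)]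
  · exact sum_congr rfl fun I _ => sum_congr rfl fun J _ => mul_comm _ _
  · intro J I
    simp only [mem_filter, mem_powersetCard]
    exact ⟨fun h => ⟨⟨h.2.2, h.1.2⟩, h.2.1⟩, fun h => ⟨⟨h.1.1.trans h.2.1, h.1.2⟩, h.2, h.1.1⟩⟩

lemma poch_inv_eq_mul {z t : F} (ht : t ≠ 0) {a s : ℕ} (hs : s ≤ a) :
    poch z t⁻¹ a = poch z t⁻¹ (a - s) * poch (t ^ (1 - (a : ℤ)) * z) t s := by
  obtain ⟨b, rfl⟩ := Nat.exists_eq_add_of_le' hs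
  rw [Nat.add_sub_cancel, poch, prod_range_add, ← prod_range_reflect _ s]
  refine congrArg₂ _ rfl (prod_congr rfl fun i hi => ?_)
  have hi' := mem_range.mp hi
  have : (t⁻¹ : F) ^ (b + (s - 1 - i)) = t ^ (1 - ((b + s : ℕ) : ℤ)) * t ^ i := by
    rw [← zpow_natCast t i, ← zpow_add₀ ht, inv_pow, ← zpow_natCast, ← zpow_neg]
    congr 1
    omega
  rw [this]
  ring

/-- The elementary symmetric sum on `S` as a combination of weighted sums over pairs of
disjoint subsets of `S`. -/
lemma elemSum_eq_sum {u : F} (hu : ∀ n : ℕ, u ^ (n + 1) ≠ 1) {x : ι → F}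
    (hx : Function.Injective x) (hx0 : ∀ i, x i ≠ 0) (z : F) {r d : ℕ} (S : Finset ι)
    (hS : #S = r + d) :
    elemSum x r S = ∑ m ∈ range (d + 1), z ^ m * poch z u (d - m) *
      ∑ J ∈ powersetCard r S, (∏ i ∈ J, x i) *
        ∑ J' ∈ powersetCard m (S \ J), crossProd u x (J ∪ J') (S \ (J ∪ J')) := by
  have hterm (m : ℕ) (hm : m ∈ range (d + 1)) :
      z ^ m * poch z u (d - m) * ∑ J ∈ powersetCard r S, (∏ i ∈ J, x i) *
        ∑ J' ∈ powersetCard m (S \ J), crossProd u x (J ∪ J') (S \ (J ∪ J'))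
      = z ^ m * poch z u (d - m) * gaussBinom u d (d - m) * elemSum x r S := by
    have hm' : m ≤ d := Nat.lt_succ_iff.mp (mem_range.mp hm)
    rw [sum_powersetCard_mul_sum_sdiff (fun I => crossProd u x I (S \ I)),
      sum_crossProd_mul_elemSum hu hx hx0 (Nat.le_add_right r m) (d - m) S (by omega),
      show r + m + (d - m) - r = d by omega]
    ring
  rw [sum_congr rfl hterm, ← sum_mul, ← sum_range_reflect]
  have h := sum_pow_mul_poch_mul_gaussBinom u z d
  rw [sum_congr rfl fun m hm => by
    rw [show d + 1 - 1 - m = d - m by omega,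
      Nat.sub_sub_self (Nat.lt_succ_iff.mp (mem_range.mp hm))], h, one_mul]

end SymmetricSums

section Indeterminates

variable (N : ℕ)

lemma algebraMap_C_algebraMap_injective : Function.Injective fun p : MvPolynomial Bool ℚ =>
    algebraMap (Rx N) (K N) (C (algebraMap (MvPolynomial Bool ℚ) Fqt p)) :=
  (IsFractionRing.injective (Rx N) (K N)).comp
    ((C_injective _ _).comp (IsFractionRing.injective (MvPolynomial Bool ℚ) Fqt))

lemma tK_ne_zero : tK N ≠ 0 := by simp [tK]

lemma tK_pow_succ_ne_one (n : ℕ) : tK N ^ (n + 1) ≠ 1 := by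
  intro h
  have := algebraMap_C_algebraMap_injective N (a₁ := X false ^ (n + 1)) (a₂ := 1)
    (by simpa [tK] using h)
  simpa using congrArg (eval fun _ => 0) this

lemma qK_mul_tK_pow_ne_one (n : ℕ) : qK N * tK N ^ n ≠ 1 := by
  intro h
  have := algebraMap_C_algebraMap_injective N (a₁ := X true * X false ^ n) (a₂ := 1)
    (by simpa [tK, qK] using h)
  simpa using congrArg (eval fun _ => 0) this

lemma poch_qK_inv_tK_inv_ne_zero (a : ℕ) : poch (qK N)⁻¹ (tK N)⁻¹ a ≠ 0 := by
  refine prod_ne_zero_iff.mpr fun i _ => sub_ne_zero.mpr fun h => qK_mul_tK_pow_ne_one N i ?_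
  rw [inv_pow, ← mul_inv] at h
  exact inv_eq_one.mp h.symm

lemma xK_injective : Function.Injective (xK : Fin N → K N) :=
  (IsFractionRing.injective (Rx N) (K N)).comp (X_injective)

lemma xK_ne_zero (i : Fin N) : xK i ≠ 0 := by simp [xK]

lemma card_highSet (ℓ : ℕ) : #(highSet N ℓ) = N - ℓ := by
  have h := card_filter_add_card_filter_not (s := (univ : Finset (Fin N))) fun i => (i : ℕ) < ℓ
  simp only [not_lt, Fin.card_filter_val_lt, card_univ, Fintype.card_fin] at h
  rw [highSet]
  omega

end Indeterminates

/-!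
Statement 7: with Ω = {1,…,N} ∖ {1,…,ℓ},
  ∑_{n=0}^{min(ℓ,k)} ∑_{L⊆{1,…,ℓ}, |L|=n} q^{n−ℓ} x_L (1/(q^{-1};t^{-1})_{N−k}) ∑_{J⊆Ω,|J|=k−n} x_J
  = ∑_{n=0}^{min(ℓ,k)} ∑_{L⊆{1,…,ℓ}, |L|=n} q^{n−ℓ} x_L
      ∑_{m'=0}^{N−k−ℓ+n} (q^{-m'}/(t^{k−N+1}q^{-1};t)_{m'+ℓ−n})
        ∑_{J⊆Ω,|J|=k−n} x_J ∑_{J'⊆Ω∖J, |J'|=m'} Ã_{J∪J'}^Ω,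
where the m'-sum is empty when N−k−ℓ+n < 0.
-/

theorem stmt7 (N k ℓ : ℕ) (h1 : ℓ ≤ N) (h2 : k ≤ N) :
    ∑ n ∈ Finset.range (min ℓ k + 1),
      ∑ L ∈ powersetCard n (lowSet N ℓ),
        (qK N) ^ ((n : ℤ) - ℓ) * xProd L *
          ((poch (qK N)⁻¹ (tK N)⁻¹ (N - k))⁻¹ *
            ∑ J ∈ powersetCard (k - n) (highSet N ℓ), xProd J)
    = ∑ n ∈ Finset.range (min ℓ k + 1),
        ∑ L ∈ powersetCard n (lowSet N ℓ),
          (qK N) ^ ((n : ℤ) - ℓ) * xProd L *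
            ∑ m' ∈ (if k + ℓ ≤ N + n then Finset.range (N + n - k - ℓ + 1) else ∅),
              (qK N)⁻¹ ^ m' /
                  poch ((tK N) ^ ((k : ℤ) - N + 1) * (qK N)⁻¹) (tK N) (m' + (ℓ - n)) *
                ∑ J ∈ powersetCard (k - n) (highSet N ℓ),
                  xProd J *
                    ∑ J' ∈ powersetCard m' (highSet N ℓ \ J),
                      Atilde (J ∪ J') (highSet N ℓ) := by
  refine sum_congr rfl fun n hn => sum_congr rfl fun L _ => ?_
  have hn' : n ≤ min ℓ k := Nat.lt_succ_iff.mp (mem_range.mp hn)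
  have hcard := card_highSet N ℓ
  congr 1
  change _ * elemSum xK (k - n) (highSet N ℓ) = _
  split_ifs with hc
  · have hp := poch_qK_inv_tK_inv_ne_zero N (N - k)
    rw [elemSum_eq_sum (u := (tK N)⁻¹) (fun m h => tK_pow_succ_ne_one N m
        (by rwa [inv_pow, inv_eq_one] at h)) (xK_injective N) (xK_ne_zero N) (qK N)⁻¹
        (d := N + n - k - ℓ) (highSet N ℓ) (by omega), mul_sum]
    refine sum_congr rfl fun m hm => ?_
    have hm' := mem_range.mp hm
    have hfac := poch_inv_eq_mul (z := (qK N)⁻¹) (tK_ne_zero N)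
      (show m + (ℓ - n) ≤ N - k by omega)
    rw [show N - k - (m + (ℓ - n)) = N + n - k - ℓ - m by omega,
      show 1 - ((N - k : ℕ) : ℤ) = (k : ℤ) - N + 1 by omega] at hfac
    rw [← mul_assoc]
    refine congrArg₂ _ ?_ rfl
    rw [hfac] at hp ⊢
    have h1 := left_ne_zero_of_mul hp
    rw [mul_inv, div_eq_mul_inv]
    linear_combination (qK N)⁻¹ ^ m * (poch ((tK N) ^ ((k : ℤ) - N + 1) * (qK N)⁻¹) (tK N)
      (m + (ℓ - n)))⁻¹ * inv_mul_cancel₀ h1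
  · rw [sum_empty, elemSum, powersetCard_eq_empty.mpr (by omega), sum_empty, mul_zero]

end
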